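/- Consider a memoryless discrete Poisson channel (K = 1, π_0 = 1) with dark noise d > 0. Fix β > 0 and a blocklength N ≥ ⌊β⌋ + 1. Define the infinite sequence κ by κ_m = A·min(1, max(β − m, 0)) for m ≥ 0 and κ_m = 0 for m < 0, and set x1*_i = κ_i and x2*_i = κ_{i − ⌈β⌉} for 0 ≤ i ≤ N−1 (so x1* starts with ⌊β⌋ entries equal to A followed by A·{β} and then zeros, and x2* is the same pattern shifted by ⌈β⌉ positions, where {β} is the fractional part of β). Then there exists a constant A* > 0 (depending only on β, d and N) such that for every A ≥ A*, with peak-power constraint A and total-power constraint P = Aβ, the pair (x1*, x2*) is optimal: for every pair x1, x2 ∈ [0, A]^N with ∑_{i=0}^{N−1} x1_i ≤ Aβ and ∑_{i=0}^{N−1} x2_i ≤ Aβ, one has P_e(x1*, x2*) ≤ P_e(x1, x2). -/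

import Mathlib

open scoped BigOperators

/-- Poisson probability mass at `k` for mean `a`. -/
noncomputable def poissonPdf (a : ℝ) (k : ℕ) : ℝ :=
  Real.exp (-a) * a ^ k / (Nat.factorial k : ℝ)

/-- Joint pmf of independent Poisson coordinates with mean vector `m`. -/
noncomputable def prodPdf {n : ℕ} (m : Fin n → ℝ) (y : Fin n → ℕ) : ℝ :=
  ∏ i, poissonPdf (m i) (y i)

/-- Average error probability of a decoder `g` for the binary hypothesis test between
independent Poisson observations with mean vectors `lam + d` (hypothesis 1) and
`mu + d` (hypothesis 2); `g y = true` means "decide hypothesis 1". -/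
noncomputable def errProb {n : ℕ} (d : ℝ) (lam mu : Fin n → ℝ)
    (g : (Fin n → ℕ) → Bool) : ℝ :=
  (1/2) * (∑' y : Fin n → ℕ, if g y = false then prodPdf (fun i => lam i + d) y else 0)
  + (1/2) * (∑' y : Fin n → ℕ, if g y = true then prodPdf (fun i => mu i + d) y else 0)

/-- Minimal (maximum-likelihood) average error probability. -/
noncomputable def Pe {n : ℕ} (d : ℝ) (lam mu : Fin n → ℝ) : ℝ :=
  ⨅ g : (Fin n → ℕ) → Bool, errProb d lam mu g

/-- Convolution of a codeword `x` of length `N` with channel coefficients `p` of length `K`,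
giving the mean vector of length `N + K - 1`. -/
noncomputable def cconv {N K : ℕ} (x : Fin N → ℝ) (p : Fin K → ℝ) :
    Fin (N + K - 1) → ℝ :=
  fun i => ∑ j : Fin K,
    p j * (if h : (j : ℕ) ≤ (i : ℕ) ∧ (i : ℕ) - (j : ℕ) < N
      then x ⟨(i : ℕ) - (j : ℕ), h.2⟩ else 0)

/-- Sum of the `k` largest entries of `v`. -/
noncomputable def topSum {m : ℕ} (v : Fin m → ℝ) (k : ℕ) : ℝ :=
  ⨆ s ∈ {s : Finset (Fin m) | s.card = k}, ∑ i ∈ s, v i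

/-- Weak submajorization (from below): every top-`k` sum of `u` is at most that of `v`. -/
def weakSubmaj {m : ℕ} (u v : Fin m → ℝ) : Prop :=
  ∀ k, 1 ≤ k → k ≤ m → topSum u k ≤ topSum v k

/-- The sequence `κ_m = A·min(1, max(β − m, 0))` for `m ≥ 0`, and `κ_m = 0` for `m < 0`. -/
noncomputable def kap (A β : ℝ) (m : ℤ) : ℝ :=
  if m < 0 then 0 else A * min 1 (max (β - (m : ℝ)) 0)

/-- The overlap `∑ min(P, Q)` of the laws of independent Poisson coordinates with means `a`, `b`. -/
noncomputable def poissonOverlap {ι : Type*} [Fintype ι] (a b : ι → ℝ) : ENNReal :=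
  ∑' y : ι → ℕ, ENNReal.ofReal (min (∏ i, poissonPdf (a i) (y i)) (∏ i, poissonPdf (b i) (y i)))

lemma poissonPdf_nonneg {a : ℝ} (ha : 0 ≤ a) (k : ℕ) : 0 ≤ poissonPdf a k := by
  unfold poissonPdf; positivity

lemma hasSum_poissonPdf (a : ℝ) : HasSum (poissonPdf a) 1 := by
  have h := (NormedSpace.expSeries_div_hasSum_exp (𝔸 := ℝ) a).mul_left (Real.exp (-a))
  rw [← Real.exp_eq_exp_ℝ, ← Real.exp_add] at h
  simp only [neg_add_cancel, Real.exp_zero] at h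
  have e : poissonPdf a = fun k => Real.exp (-a) * (a ^ k / (k.factorial : ℝ)) :=
    funext fun k => mul_div_assoc _ _ _
  rwa [e]

lemma tsum_ofReal_poissonPdf {a : ℝ} (ha : 0 ≤ a) :
    ∑' k, ENNReal.ofReal (poissonPdf a k) = 1 := by
  rw [← ENNReal.ofReal_tsum_of_nonneg (poissonPdf_nonneg ha) (hasSum_poissonPdf a).summable,
    (hasSum_poissonPdf a).tsum_eq, ENNReal.ofReal_one]

lemma ENNReal_tsum_pi_prod {n : ℕ} (f : Fin n → ℕ → ENNReal) :
    ∑' y : Fin n → ℕ, ∏ i, f i (y i) = ∏ i, ∑' k, f i k := by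
  induction n with
  | zero => simp
  | succ n ih =>
    rw [← (Fin.consEquiv (fun _ : Fin (n + 1) => ℕ)).tsum_eq, ENNReal.tsum_prod',
      Fin.prod_univ_succ, ← ih, ← ENNReal.tsum_mul_right]
    refine tsum_congr fun k => ?_
    rw [← ENNReal.tsum_mul_left]
    refine tsum_congr fun y => ?_
    simp [Fin.consEquiv, Fin.prod_univ_succ]

lemma poissonOverlap_comm {ι : Type*} [Fintype ι] (a b : ι → ℝ) :
    poissonOverlap a b = poissonOverlap b a := by
  simp only [poissonOverlap, min_comm]

lemma sum_piAntidiag_prod_poissonPdf {ι : Type*} [Fintype ι] [DecidableEq ι] (c : ι → ℝ) (n : ℕ) :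
    ∑ w ∈ Finset.piAntidiag Finset.univ n, ∏ i, poissonPdf (c i) (w i)
      = poissonPdf (∑ i, c i) n := by
  have hn : (n.factorial : ℝ) ≠ 0 := by positivity
  unfold poissonPdf
  rw [Finset.sum_pow_eq_sum_piAntidiag, Finset.mul_sum, Finset.sum_div]
  refine Finset.sum_congr rfl fun w hw => ?_
  rw [Finset.mem_piAntidiag] at hw
  have h := Nat.multinomial_spec Finset.univ w
  rw [hw.1] at h
  have h' : (∏ i, ((w i).factorial : ℝ)) * (Nat.multinomial Finset.univ w : ℝ)
      = n.factorial := by exact_mod_cast h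
  have hp : (∏ i, ((w i).factorial : ℝ)) ≠ 0 :=
    Finset.prod_ne_zero_iff.2 fun i _ => by positivity
  rw [Finset.prod_div_distrib, Finset.prod_mul_distrib, ← Real.exp_sum,
    Finset.sum_neg_distrib, div_eq_div_iff hp hn, ← h']
  ring

section Splitting

variable {J I : Type*} [Fintype J] [Fintype I]

/-- The overlap of two product Poisson laws on arrays of counts. -/
noncomputable def arrayOverlap (c c' : J → I → ℝ) : ENNReal :=
  ∑' z : J → I → ℕ, ENNReal.ofReal
    (min (∏ j, ∏ i, poissonPdf (c j i) (z j i)) (∏ j, ∏ i, poissonPdf (c' j i) (z j i)))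

lemma arrayOverlap_swap (c c' : J → I → ℝ) :
    arrayOverlap c c' = arrayOverlap (fun i j => c j i) (fun i j => c' j i) := by
  unfold arrayOverlap
  rw [← (Equiv.piComm (fun (_ : I) (_ : J) => ℕ)).tsum_eq]
  refine tsum_congr fun z => ?_
  simp only [Equiv.piComm_apply, Function.swap]
  rw [Finset.prod_comm, Finset.prod_comm (f := fun j i => poissonPdf (c' j i) (z i j))]

lemma prod_poissonPdf_thinning (D : J → I → ℝ) (hD1 : ∀ j, ∑ i, D j i = 1) (a : J → ℝ)
    (z : J → I → ℕ) :
    ∏ j, ∏ i, poissonPdf (D j i * a j) (z j i)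
      = (∏ j, Real.exp (-a j) * a j ^ (∑ i, z j i))
        * ∏ j, ∏ i, D j i ^ z j i / ((z j i).factorial : ℝ) := by
  rw [← Finset.prod_mul_distrib]
  refine Finset.prod_congr rfl fun j _ => ?_
  have h : Real.exp (-a j) = ∏ i, Real.exp (-(D j i * a j)) := by
    rw [← Real.exp_sum, Finset.sum_neg_distrib, ← Finset.sum_mul, hD1, one_mul]
  rw [h, ← Finset.prod_pow_eq_pow_sum, ← Finset.prod_mul_distrib, ← Finset.prod_mul_distrib]
  refine Finset.prod_congr rfl fun i _ => ?_
  rw [poissonPdf, mul_pow]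
  ring

variable [DecidableEq J] [DecidableEq I]

/-- Arrays of counts with prescribed row sums. -/
def rowFiber (I : Type*) [Fintype I] [DecidableEq I] (y : J → ℕ) : Finset (J → I → ℕ) :=
  Fintype.piFinset fun j => Finset.piAntidiag Finset.univ (y j)

lemma mem_rowFiber {y : J → ℕ} {z : J → I → ℕ} :
    z ∈ rowFiber I y ↔ (fun j => ∑ i, z j i) = y := by
  simp [rowFiber, funext_iff]

lemma sum_rowFiber_prod_poissonPdf (c : J → I → ℝ) (y : J → ℕ) :
    ∑ z ∈ rowFiber I y, ∏ j, ∏ i, poissonPdf (c j i) (z j i)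
      = ∏ j, poissonPdf (∑ i, c j i) (y j) := by
  unfold rowFiber
  rw [← Finset.prod_univ_sum (fun j => Finset.piAntidiag Finset.univ (y j))
    (fun j (w : I → ℕ) => ∏ i, poissonPdf (c j i) (w i))]
  exact Finset.prod_congr rfl fun j _ => sum_piAntidiag_prod_poissonPdf _ _

lemma tsum_eq_tsum_sum_rowFiber (F : (J → I → ℕ) → ENNReal) :
    ∑' z, F z = ∑' y : J → ℕ, ∑ z ∈ rowFiber I y, F z := by
  rw [← ENNReal.tsum_fiberwise F (fun z j => ∑ i, z j i)]
  refine tsum_congr fun y => ?_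
  have h : ((fun z : J → I → ℕ => fun j => ∑ i, z j i) ⁻¹' {y}) = ↑(rowFiber I y) := by
    ext z
    simp [mem_rowFiber]
  rw [h, Finset.tsum_subtype']

lemma arrayOverlap_le (c c' : J → I → ℝ) (hc : ∀ j i, 0 ≤ c j i) (hc' : ∀ j i, 0 ≤ c' j i) :
    arrayOverlap c c' ≤ poissonOverlap (fun j => ∑ i, c j i) (fun j => ∑ i, c' j i) := by
  unfold arrayOverlap poissonOverlap
  rw [tsum_eq_tsum_sum_rowFiber]
  refine ENNReal.tsum_le_tsum fun y => ?_
  rw [← ENNReal.ofReal_sum_of_nonneg]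
  · refine ENNReal.ofReal_le_ofReal (le_min ?_ ?_)
    · rw [← sum_rowFiber_prod_poissonPdf]
      exact Finset.sum_le_sum fun z _ => min_le_left _ _
    · rw [← sum_rowFiber_prod_poissonPdf]
      exact Finset.sum_le_sum fun z _ => min_le_right _ _
  · exact fun z _ => le_min
      (Finset.prod_nonneg fun j _ => Finset.prod_nonneg fun i _ => poissonPdf_nonneg (hc j i) _)
      (Finset.prod_nonneg fun j _ => Finset.prod_nonneg fun i _ => poissonPdf_nonneg (hc' j i) _)

/-- Splitting each Poisson count multinomially does not change the overlap: the original counts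
are a sufficient statistic. -/
lemma poissonOverlap_le_arrayOverlap (D : J → I → ℝ) (hD : ∀ j i, 0 ≤ D j i)
    (hD1 : ∀ j, ∑ i, D j i = 1) (a b : J → ℝ) (ha : ∀ j, 0 ≤ a j) (hb : ∀ j, 0 ≤ b j) :
    poissonOverlap a b ≤ arrayOverlap (fun j i => D j i * a j) (fun j i => D j i * b j) := by
  unfold arrayOverlap poissonOverlap
  rw [tsum_eq_tsum_sum_rowFiber]
  refine ENNReal.tsum_le_tsum fun y => ?_
  have hsum (a : J → ℝ) : ∏ j, poissonPdf (a j) (y j)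
      = (∏ j, Real.exp (-a j) * a j ^ y j)
        * ∑ z ∈ rowFiber I y, ∏ j, ∏ i, D j i ^ z j i / ((z j i).factorial : ℝ) := by
    have := sum_rowFiber_prod_poissonPdf (fun j i => D j i * a j) y
    simp only [← Finset.sum_mul, hD1, one_mul] at this
    rw [← this, Finset.mul_sum]
    refine Finset.sum_congr rfl fun z hz => ?_
    rw [prod_poissonPdf_thinning D hD1, ← mem_rowFiber.1 hz]
  have hnn (z : J → I → ℕ) : 0 ≤ ∏ j, ∏ i, D j i ^ z j i / ((z j i).factorial : ℝ) :=
    Finset.prod_nonneg fun j _ => Finset.prod_nonneg fun i _ =>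
      div_nonneg (pow_nonneg (hD j i) _) (by positivity)
  rw [← ENNReal.ofReal_sum_of_nonneg]
  · refine ENNReal.ofReal_le_ofReal (le_of_eq ?_)
    rw [hsum a, hsum b, ← min_mul_of_nonneg _ _ (Finset.sum_nonneg fun z _ => hnn z),
      Finset.mul_sum]
    refine Finset.sum_congr rfl fun z hz => ?_
    rw [prod_poissonPdf_thinning D hD1, prod_poissonPdf_thinning D hD1,
      ← min_mul_of_nonneg _ _ (hnn z), ← mem_rowFiber.1 hz]
  · exact fun z _ => le_min
      (Finset.prod_nonneg fun j _ => Finset.prod_nonneg fun i _ =>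
        poissonPdf_nonneg (mul_nonneg (hD j i) (ha j)) _)
      (Finset.prod_nonneg fun j _ => Finset.prod_nonneg fun i _ =>
        poissonPdf_nonneg (mul_nonneg (hD j i) (hb j)) _)

lemma poissonOverlap_le_of_stochastic (D : J → I → ℝ) (hD : ∀ j i, 0 ≤ D j i)
    (hD1 : ∀ j, ∑ i, D j i = 1) (a b : J → ℝ) (ha : ∀ j, 0 ≤ a j) (hb : ∀ j, 0 ≤ b j) :
    poissonOverlap a b
      ≤ poissonOverlap (fun i => ∑ j, D j i * a j) (fun i => ∑ j, D j i * b j) := by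
  refine (poissonOverlap_le_arrayOverlap D hD hD1 a b ha hb).trans ?_
  rw [arrayOverlap_swap]
  exact arrayOverlap_le _ _ (fun i j => mul_nonneg (hD j i) (ha j))
    (fun i j => mul_nonneg (hD j i) (hb j))

end Splitting

section Extension

variable {ι : Type*} [Fintype ι]

lemma poissonOverlap_option (a b : Option ι → ℝ) :
    poissonOverlap a b = ∑' y : ι → ℕ, ∑' k : ℕ, ENNReal.ofReal
      (min (poissonPdf (a none) k * ∏ i, poissonPdf (a (some i)) (y i))
        (poissonPdf (b none) k * ∏ i, poissonPdf (b (some i)) (y i))) := by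
  unfold poissonOverlap
  rw [← (Equiv.piOptionEquivProd (β := fun _ : Option ι => ℕ)).symm.tsum_eq, ENNReal.tsum_prod',
    ENNReal.tsum_comm]
  simp [Fintype.prod_option]

lemma poissonOverlap_option_le (a b : Option ι → ℝ) (ha : ∀ i, 0 ≤ a i) (hb : ∀ i, 0 ≤ b i) :
    poissonOverlap a b ≤ poissonOverlap (fun i => a (some i)) (fun i => b (some i)) := by
  rw [poissonOverlap_option]
  refine ENNReal.tsum_le_tsum fun y => ?_
  have key (a b : Option ι → ℝ) (ha : ∀ i, 0 ≤ a i) :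
      ∑' k : ℕ, ENNReal.ofReal
      (min (poissonPdf (a none) k * ∏ i, poissonPdf (a (some i)) (y i))
        (poissonPdf (b none) k * ∏ i, poissonPdf (b (some i)) (y i)))
      ≤ ENNReal.ofReal (∏ i, poissonPdf (a (some i)) (y i)) := by
    calc _ ≤ ∑' k : ℕ, ENNReal.ofReal (poissonPdf (a none) k)
            * ENNReal.ofReal (∏ i, poissonPdf (a (some i)) (y i)) := by
          refine ENNReal.tsum_le_tsum fun k => ?_
          rw [← ENNReal.ofReal_mul (poissonPdf_nonneg (ha none) k)]
          exact ENNReal.ofReal_le_ofReal (min_le_left _ _)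
      _ = _ := by rw [ENNReal.tsum_mul_right, tsum_ofReal_poissonPdf (ha none), one_mul]
  rw [ENNReal.ofReal_min]
  refine le_min (key a b ha) ?_
  exact (tsum_congr fun k => by rw [min_comm]).le.trans (key b a hb)

lemma poissonOverlap_option_eq (a b : Option ι → ℝ) (ha : 0 ≤ a none) (hab : a none = b none) :
    poissonOverlap a b = poissonOverlap (fun i => a (some i)) (fun i => b (some i)) := by
  rw [poissonOverlap_option]
  refine tsum_congr fun y => ?_
  simp_rw [← hab, ← mul_min_of_nonneg _ _ (poissonPdf_nonneg ha _),
    ENNReal.ofReal_mul (poissonPdf_nonneg ha _)]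
  rw [ENNReal.tsum_mul_right, tsum_ofReal_poissonPdf ha, one_mul]

/-- Data processing: independent thinning and rerouting of the counts according to a substochastic
matrix, followed by the addition of independent Poisson noise, does not decrease the overlap. -/
lemma poissonOverlap_le_of_substochastic [DecidableEq ι] (D : ι → ι → ℝ) (hD : ∀ i j, 0 ≤ D i j)
    (hD1 : ∀ j, ∑ i, D i j ≤ 1) (a b ν : ι → ℝ) (ha : ∀ j, 0 ≤ a j) (hb : ∀ j, 0 ≤ b j)
    (hν : ∀ i, 0 ≤ ν i) :
    poissonOverlap a b
      ≤ poissonOverlap (fun i => ∑ j, D i j * a j + ν i) (fun i => ∑ j, D i j * b j + ν i) := by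
  have hs : 0 ≤ ∑ i, ν i := Finset.sum_nonneg fun i _ => hν i
  set e : ℝ := ∑ i, ν i + 1 with he
  have he0 : 0 < e := by positivity
  let ext (a : ι → ℝ) : Option ι → ℝ := fun j => j.elim e a
  let D' : Option ι → Option ι → ℝ := fun j i =>
    j.elim (i.elim (1 / e) fun i => ν i / e) fun j => i.elim (1 - ∑ i, D i j) fun i => D i j
  have hext (a : ι → ℝ) (ha : ∀ j, 0 ≤ a j) : ∀ j, 0 ≤ ext a j := by
    rintro (_ | j)
    exacts [he0.le, ha j]
  have hD' : ∀ j i, 0 ≤ D' j i := by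
    rintro (_ | j) (_ | i)
    exacts [by simp only [D', Option.elim]; positivity, div_nonneg (hν i) he0.le,
      sub_nonneg.2 (hD1 j), hD i j]
  have hD'1 : ∀ j, ∑ i, D' j i = 1 := by
    rintro (_ | j)
    · simp only [D', Fintype.sum_option, Option.elim, ← Finset.sum_div]
      rw [← add_div, add_comm, ← he, div_self he0.ne']
    · simp [D', Fintype.sum_option]
  have hout (a : ι → ℝ) (i : ι) :
      ∑ j, D' j (some i) * ext a j = ∑ j, D i j * a j + ν i := by
    simp only [D', ext, Fintype.sum_option, Option.elim]
    field_simp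
    ring
  have h1 := poissonOverlap_option_eq (ext a) (ext b) he0.le rfl
  have h2 := poissonOverlap_le_of_stochastic D' hD' hD'1 (ext a) (ext b) (hext a ha) (hext b hb)
  have h3 := poissonOverlap_option_le (fun i => ∑ j, D' j i * ext a j)
    (fun i => ∑ j, D' j i * ext b j)
    (fun i => Finset.sum_nonneg fun j _ => mul_nonneg (hD' j i) (hext a ha j))
    (fun i => Finset.sum_nonneg fun j _ => mul_nonneg (hD' j i) (hext b hb j))
  simp only [hout] at h3
  exact h1.symm.le.trans (h2.trans h3)

end Extension

/-- The minimal error probability is half of the overlap. -/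
lemma Pe_eq_half_poissonOverlap {n : ℕ} {d : ℝ} (hd : 0 < d) (lam mu : Fin n → ℝ) (hl : ∀ i, 0 ≤ lam i)
    (hm : ∀ i, 0 ≤ mu i) :
    Pe d lam mu = (1 / 2) * (poissonOverlap (fun i => lam i + d) (fun i => mu i + d)).toReal := by
  have hnn (m : Fin n → ℝ) (h : ∀ i, 0 ≤ m i) (y : Fin n → ℕ) : 0 ≤ prodPdf (fun i => m i + d) y :=
    Finset.prod_nonneg fun i _ => poissonPdf_nonneg (by linarith [h i]) _
  have hsumm (m : Fin n → ℝ) (h : ∀ i, 0 ≤ m i) : Summable (prodPdf fun i => m i + d) := by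
    have h1 : ∑' y, ENNReal.ofReal (prodPdf (fun i => m i + d) y) = 1 := by
      simp only [prodPdf]
      simp_rw [ENNReal.ofReal_prod_of_nonneg fun i _ =>
        poissonPdf_nonneg (add_nonneg (h i) hd.le) _]
      rw [ENNReal_tsum_pi_prod fun i k => ENNReal.ofReal (poissonPdf (m i + d) k)]
      exact Finset.prod_eq_one fun i _ => tsum_ofReal_poissonPdf (add_nonneg (h i) hd.le)
    have h2 := ENNReal.summable_toReal (h1.trans_ne ENNReal.one_ne_top)
    exact h2.congr fun y => ENNReal.toReal_ofReal (hnn m h y)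
  set P := prodPdf fun i => lam i + d with hP
  set Q := prodPdf fun i => mu i + d with hQ
  have hPn := hnn lam hl
  have hQn := hnn mu hm
  have hPs := hsumm lam hl
  have hQs := hsumm mu hm
  have hmins : Summable fun y => min (P y) (Q y) :=
    hPs.of_nonneg_of_le (fun y => le_min (hPn y) (hQn y)) fun y => min_le_left _ _
  have hR : (poissonOverlap (fun i => lam i + d) (fun i => mu i + d)).toReal
      = ∑' y, min (P y) (Q y) := by
    have : poissonOverlap (fun i => lam i + d) (fun i => mu i + d)
        = ENNReal.ofReal (∑' y, min (P y) (Q y)) := by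
      rw [ENNReal.ofReal_tsum_of_nonneg (fun y => le_min (hPn y) (hQn y)) hmins]
      rfl
    rw [this, ENNReal.toReal_ofReal (tsum_nonneg fun y => le_min (hPn y) (hQn y))]
  have herr (g : (Fin n → ℕ) → Bool) :
      errProb d lam mu g = (1 / 2) * ∑' y, if g y = true then Q y else P y := by
    have s1 : Summable fun y => if g y = false then P y else 0 :=
      hPs.of_nonneg_of_le (fun y => by
          split_ifs
          exacts [hPn y, le_rfl])
        (fun y => by
          split_ifs
          exacts [le_rfl, hPn y])
    have s2 : Summable fun y => if g y = true then Q y else 0 :=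
      hQs.of_nonneg_of_le (fun y => by
          split_ifs
          exacts [hQn y, le_rfl])
        (fun y => by
          split_ifs
          exacts [le_rfl, hQn y])
    rw [errProb, ← mul_add, ← s1.tsum_add s2]
    congr 1
    refine tsum_congr fun y => ?_
    cases g y <;> simp
  have hle (g : (Fin n → ℕ) → Bool) :
      (1 / 2) * ∑' y, min (P y) (Q y) ≤ errProb d lam mu g := by
    rw [herr]
    refine mul_le_mul_of_nonneg_left (hmins.tsum_le_tsum (fun y => ?_) ?_) (by norm_num)
    · split_ifs
      exacts [min_le_right _ _, min_le_left _ _]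
    · refine (hPs.add hQs).of_nonneg_of_le (fun y => ?_) fun y => ?_
      · split_ifs
        exacts [hQn y, hPn y]
      · split_ifs
        exacts [le_add_of_nonneg_left (hPn y), le_add_of_nonneg_right (hQn y)]
  rw [hR]
  refine le_antisymm ?_ (le_ciInf hle)
  refine (ciInf_le ⟨_, Set.forall_mem_range.2 hle⟩ fun y => decide (Q y ≤ P y)).trans ?_
  rw [herr]
  refine le_of_eq (congrArg _ (tsum_congr fun y => ?_))
  by_cases h : Q y ≤ P y
  · simp [h]
  · simp [h, (not_le.1 h).le]

/-- Any vector in `[0,1]^ι` of total mass at most `f + r` is obtained from `(1, …, 1, r)` by a doubly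
substochastic matrix whose first `f` columns are equal to `α` and whose last column is `γ`. -/
lemma exists_substochastic_columns {ι : Type*} [Fintype ι] (f : ℕ) (r : ℝ) (hr : 0 < r)
    (hr1 : r ≤ 1) (u : ι → ℝ) (hu0 : ∀ i, 0 ≤ u i) (hu1 : ∀ i, u i ≤ 1)
    (hu : ∑ i, u i ≤ f + r) :
    ∃ α γ : ι → ℝ, (∀ i, 0 ≤ α i) ∧ (∀ i, 0 ≤ γ i) ∧ ∑ i, α i ≤ 1 ∧ ∑ i, γ i ≤ 1 ∧
      (∀ i, f * α i + γ i ≤ 1) ∧ ∀ i, f * α i + r * γ i = u i := by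
  classical
  rcases Nat.eq_zero_or_pos f with rfl | hf
  · have hu' : ∑ i, u i ≤ r := by simpa using hu
    refine ⟨0, fun i => u i / r, by simp, fun i => div_nonneg (hu0 i) hr.le, by simp, ?_, ?_, ?_⟩
    · rw [← Finset.sum_div]
      exact (div_le_one hr).2 hu'
    · intro i
      have : u i ≤ ∑ i, u i := Finset.single_le_sum (fun i _ => hu0 i) (Finset.mem_univ i)
      simpa using (div_le_one hr).2 (this.trans hu')
    · intro i
      simp only [Pi.zero_apply, mul_zero, zero_add]
      field_simp
  have hf' : (0 : ℝ) < f := by exact_mod_cast hf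
  rcases hr1.eq_or_lt with rfl | hr1
  · have hpos : (0 : ℝ) < f + 1 := by positivity
    have hsum : ∑ i, u i / ((f : ℝ) + 1) ≤ 1 := by
      rw [← Finset.sum_div]
      exact (div_le_one hpos).2 hu
    have heq (i : ι) : f * (u i / ((f : ℝ) + 1)) + u i / ((f : ℝ) + 1) = u i := by
      field_simp
    refine ⟨fun i => u i / (f + 1), fun i => u i / (f + 1), fun i => div_nonneg (hu0 i) hpos.le,
      fun i => div_nonneg (hu0 i) hpos.le, hsum, hsum, fun i => (heq i).trans_le (hu1 i), ?_⟩
    simpa using heq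
  have hq : 0 < 1 - r := sub_pos.2 hr1
  -- It suffices to choose the last column `γ`.
  suffices h : ∃ γ : ι → ℝ, (∀ i, 0 ≤ γ i) ∧ (∀ i, r * γ i ≤ u i) ∧ (∀ i, (1 - r) * γ i ≤ 1 - u i) ∧
      ∑ i, γ i ≤ 1 ∧ ∑ i, u i - f ≤ r * ∑ i, γ i by
    obtain ⟨γ, h0, h1, h2, h3, h4⟩ := h
    have heq (i : ι) : f * ((u i - r * γ i) / f) = u i - r * γ i := by field_simp
    refine ⟨fun i => (u i - r * γ i) / f, γ, fun i => div_nonneg (by linarith [h1 i]) hf'.le, h0, ?_,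
      h3, fun i => ?_, fun i => ?_⟩
    · rw [← Finset.sum_div, div_le_one hf', Finset.sum_sub_distrib, ← Finset.mul_sum]
      linarith
    · rw [heq]
      linarith [h2 i]
    · rw [heq]
      ring
  set g : ι → ℝ := fun i => min (u i / r) ((1 - u i) / (1 - r)) with hg
  have g0 (i : ι) : 0 ≤ g i :=
    le_min (div_nonneg (hu0 i) hr.le) (div_nonneg (sub_nonneg.2 (hu1 i)) hq.le)
  have g1 (i : ι) : r * g i ≤ u i := by
    have := (le_div_iff₀ hr).1 (min_le_left (u i / r) ((1 - u i) / (1 - r)))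
    linarith
  have g2 (i : ι) : (1 - r) * g i ≤ 1 - u i := by
    have := (le_div_iff₀ hq).1 (min_le_right (u i / r) ((1 - u i) / (1 - r)))
    linarith
  have hG0 : 0 ≤ ∑ i, g i := Finset.sum_nonneg fun i _ => g0 i
  have hG : ∑ i, u i - f ≤ r * ∑ i, g i := by
    set H := Finset.univ.filter fun i => r ≤ u i with hH
    set L := Finset.univ.filter fun i => ¬ r ≤ u i with hL
    have hsplit (v : ι → ℝ) : ∑ i ∈ H, v i + ∑ i ∈ L, v i = ∑ i, v i :=
      Finset.sum_filter_add_sum_filter_not _ _ _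
    have hLsum : ∑ i ∈ L, u i = r * ∑ i ∈ L, g i := by
      rw [Finset.mul_sum]
      refine Finset.sum_congr rfl fun i hi => ?_
      have hi' : u i < r := not_le.1 (Finset.mem_filter.1 hi).2
      have h1 : u i / r ≤ 1 := (div_le_one hr).2 hi'.le
      have h2 : 1 ≤ (1 - u i) / (1 - r) := (one_le_div hq).2 (by linarith)
      rw [hg]
      simp only [min_eq_left (h1.trans h2)]
      field_simp
    have hHsum : (1 - r) * ∑ i ∈ H, g i = H.card - ∑ i ∈ H, u i := by
      have : (H.card : ℝ) - ∑ i ∈ H, u i = ∑ i ∈ H, (1 - u i) := by simp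
      rw [this, Finset.mul_sum]
      refine Finset.sum_congr rfl fun i hi => ?_
      have hi' : r ≤ u i := (Finset.mem_filter.1 hi).2
      have h1 : 1 ≤ u i / r := (one_le_div hr).2 hi'
      have h2 : (1 - u i) / (1 - r) ≤ 1 := (div_le_one hq).2 (by linarith)
      rw [hg]
      simp only [min_eq_right (h2.trans h1)]
      field_simp
    have hHg : 0 ≤ ∑ i ∈ H, g i := Finset.sum_nonneg fun i _ => g0 i
    have hLu : 0 ≤ ∑ i ∈ L, u i := Finset.sum_nonneg fun i _ => hu0 i
    have e1 := hsplit u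
    have e2 := hsplit g
    have hHle : ∑ i ∈ H, u i ≤ H.card := by
      simpa using Finset.sum_le_sum (s := H) fun i _ => hu1 i
    suffices h : ∑ i ∈ H, u i - f ≤ r * ∑ i ∈ H, g i by
      rw [← e1, ← e2, mul_add]
      linarith
    rcases Nat.lt_or_ge f H.card with hcard | hcard
    · have hc : (f : ℝ) + 1 ≤ H.card := by exact_mod_cast hcard
      have h1 : 1 ≤ ∑ i ∈ H, g i := by
        by_contra hlt
        have := mul_lt_mul_of_pos_left (not_le.1 hlt) hq
        linarith
      nlinarith
    · have hc : (H.card : ℝ) ≤ f := by exact_mod_cast hcard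
      have := mul_nonneg hr.le hHg
      linarith
  rcases le_or_gt (∑ i, g i) 1 with hG1 | hG1
  · exact ⟨g, g0, g1, g2, hG1, hG⟩
  · set G := ∑ i, g i with hGdef
    have hGpos : 0 < G := by linarith
    have hle (i : ι) : g i / G ≤ g i := div_le_self (g0 i) hG1.le
    have hone : ∑ i, g i / G = 1 := by rw [← Finset.sum_div, ← hGdef, div_self hGpos.ne']
    refine ⟨fun i => g i / G, fun i => div_nonneg (g0 i) hGpos.le,
      fun i => (mul_le_mul_of_nonneg_left (hle i) hr.le).trans (g1 i),
      fun i => (mul_le_mul_of_nonneg_left (hle i) hq.le).trans (g2 i), hone.le, ?_⟩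
    rw [hone]
    linarith

/-- The normalized profile `1, …, 1, {β}, 0, …`. -/
noncomputable def unitProfile (β : ℝ) (j : ℕ) : ℝ := min 1 (max (β - j) 0)

lemma exists_substochastic_unitProfile {ι : Type*} [Fintype ι] {β : ℝ} {f : ℕ} (hf : (f : ℝ) < β)
    (hf1 : β ≤ f + 1) (m : ℕ) (u : ι → ℝ) (hu0 : ∀ i, 0 ≤ u i) (hu1 : ∀ i, u i ≤ 1)
    (hu : ∑ i, u i ≤ β) (hm : f + 1 ≤ m ∨ ∑ i, u i ≤ m) :
    ∃ E : ι → ℕ → ℝ, (∀ i j, 0 ≤ E i j) ∧ (∀ j, ∑ i, E i j ≤ 1) ∧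
      (∀ i, ∑ j ∈ Finset.range m, E i j ≤ 1) ∧
      ∀ i, ∑ j ∈ Finset.range m, E i j * unitProfile β j = u i := by
  have w1 (j : ℕ) (hj : j < f) : unitProfile β j = 1 := by
    have : (j : ℝ) + 1 ≤ f := by exact_mod_cast hj
    exact min_eq_left (le_max_of_le_left (by linarith))
  have w2 : unitProfile β f = β - f := by
    rw [unitProfile, max_eq_left (by linarith), min_eq_right (by linarith)]
  rcases Nat.lt_or_ge f m with hfm | hfm
  · obtain ⟨α, γ, hα, hγ, hα1, hγ1, hrow, heq⟩ := exists_substochastic_columns f (β - f)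
      (by linarith) (by linarith) u hu0 hu1 (by linarith)
    have hsum (i : ι) (w : ℕ → ℝ) :
        ∑ j ∈ Finset.range m, (if j < f then α i else if j = f then γ i else 0) * w j
          = ∑ j ∈ Finset.range f, α i * w j + γ i * w f := by
      rw [← Finset.sum_subset (Finset.range_subset_range.2 (Nat.succ_le_of_lt hfm)), Finset.sum_range_succ]
      · simp only [lt_irrefl, if_false, if_true]
        congr 1
        exact Finset.sum_congr rfl fun j hj => by rw [if_pos (Finset.mem_range.1 hj)]
      · intro j _ hj
        have := Finset.mem_range.not.1 hj
        rw [if_neg (by omega), if_neg (by omega), zero_mul]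
    refine ⟨fun i j => if j < f then α i else if j = f then γ i else 0, ?_, ?_, ?_, ?_⟩
    · intro i j
      dsimp only
      split_ifs
      exacts [hα i, hγ i, le_rfl]
    · intro j
      dsimp only
      split_ifs
      exacts [hα1, hγ1, by simp]
    · intro i
      have := hsum i 1
      simp only [Pi.one_apply, mul_one, Finset.sum_const, Finset.card_range, nsmul_eq_mul] at this
      rw [this]
      exact hrow i
    · intro i
      rw [hsum i, w2, Finset.sum_congr rfl fun j hj => by
        rw [w1 j (Finset.mem_range.1 hj), mul_one]]
      rw [Finset.sum_const, Finset.card_range, nsmul_eq_mul, mul_comm (γ i)]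
      exact heq i
  · have hm' : ∑ i, u i ≤ m := hm.resolve_left (by omega)
    rcases Nat.eq_zero_or_pos m with rfl | hpos
    · refine ⟨0, by simp, by simp, by simp, fun i => ?_⟩
      have : u i ≤ ∑ i, u i := Finset.single_le_sum (fun i _ => hu0 i) (Finset.mem_univ i)
      have h0 : ∑ i, u i ≤ 0 := by simpa using hm'
      simpa using le_antisymm (hu0 i) (this.trans h0)
    · have hpos' : (0 : ℝ) < m := by exact_mod_cast hpos
      refine ⟨fun i _ => u i / m, fun i _ => div_nonneg (hu0 i) hpos'.le, fun _ => ?_, fun i => ?_,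
        fun i => ?_⟩
      · rw [← Finset.sum_div]
        exact (div_le_one hpos').2 hm'
      · rw [Finset.sum_const, Finset.card_range, nsmul_eq_mul, mul_div_cancel₀ _ hpos'.ne']
        exact hu1 i
      · rw [Finset.sum_congr rfl fun j hj => by
          rw [w1 j (by have := Finset.mem_range.1 hj; omega), mul_one]]
        rw [Finset.sum_const, Finset.card_range, nsmul_eq_mul, mul_div_cancel₀ _ hpos'.ne']

lemma unitProfile_eq_zero {β : ℝ} {j : ℕ} (h : β ≤ j) : unitProfile β j = 0 := by
  rw [unitProfile, max_eq_right (by linarith), min_eq_right zero_le_one]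

lemma unitProfile_nonneg (β : ℝ) (j : ℕ) : 0 ≤ unitProfile β j :=
  le_min zero_le_one (le_max_right _ _)

lemma unitProfile_le_one (β : ℝ) (j : ℕ) : unitProfile β j ≤ 1 := min_le_left _ _

lemma sum_range_unitProfile {β : ℝ} {f : ℕ} (hf : (f : ℝ) < β) (hf1 : β ≤ f + 1) :
    ∑ j ∈ Finset.range (f + 1), unitProfile β j = β := by
  have w1 : ∀ j ∈ Finset.range f, unitProfile β j = 1 := fun j hj => by
    have : (j : ℝ) + 1 ≤ f := by exact_mod_cast Finset.mem_range.1 hj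
    exact min_eq_left (le_max_of_le_left (by linarith))
  rw [Finset.sum_range_succ, Finset.sum_congr rfl w1, unitProfile, max_eq_left (by linarith),
    min_eq_right (by linarith)]
  simp

lemma kap_natCast (A β : ℝ) (j : ℕ) : kap A β (j : ℤ) = A * unitProfile β j := by
  simp [kap, unitProfile]

lemma kap_sub (A β : ℝ) (j c : ℕ) :
    kap A β ((j : ℤ) - (c : ℤ)) = if j < c then 0 else A * unitProfile β (j - c) := by
  split_ifs with h
  · rw [kap, if_pos (by omega)]
  · rw [← Nat.cast_sub (not_lt.1 h), kap_natCast]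

lemma sum_fin_add_ite (c k : ℕ) (g h : ℕ → ℝ) :
    ∑ j : Fin (c + k), (if (j : ℕ) < c then g j else h (j - c))
      = ∑ j ∈ Finset.range c, g j + ∑ j ∈ Finset.range k, h j := by
  rw [Fin.sum_univ_eq_sum_range (fun j => if j < c then g j else h (j - c)) (c + k),
    Finset.sum_range_add]
  congr 1
  · exact Finset.sum_congr rfl fun j hj => if_pos (Finset.mem_range.1 hj)
  · exact Finset.sum_congr rfl fun j _ => by rw [if_neg (by omega), Nat.add_sub_cancel_left]

lemma sum_max_sub_le {ι : Type*} [Fintype ι] {A : ℝ} (x1 x2 : ι → ℝ)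
    (hx1 : ∀ i, x1 i ≤ A) (hx2 : ∀ i, 0 ≤ x2 i) :
    ∑ i, max (x1 i - x2 i) 0 ≤ (Finset.univ.filter fun i => x2 i < x1 i).card * A := by
  rw [← nsmul_eq_mul, ← Finset.sum_const, Finset.sum_filter]
  refine Finset.sum_le_sum fun i _ => ?_
  split_ifs with h
  · exact max_le (by linarith [hx1 i, hx2 i]) (by linarith [hx1 i, hx2 i])
  · rw [max_eq_right (by linarith)]

/-- The staggered pair is at least as good as any pair whose first codeword dominates on at least
`⌈β⌉` coordinates. -/
lemma poissonOverlap_staggered_le {A β d : ℝ} {f k : ℕ} (hA : 0 < A) (hd : 0 < d)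
    (hf : (f : ℝ) < β) (hf1 : β ≤ f + 1) (x1 x2 : Fin (f + 1 + k) → ℝ)
    (hx1 : ∀ i, 0 ≤ x1 i ∧ x1 i ≤ A) (hx2 : ∀ i, 0 ≤ x2 i ∧ x2 i ≤ A)
    (hs1 : ∑ i, x1 i ≤ A * β) (hs2 : ∑ i, x2 i ≤ A * β)
    (hcard : f + 1 ≤ (Finset.univ.filter fun i => x2 i ≤ x1 i).card) :
    poissonOverlap (fun i : Fin (f + 1 + k) => A * unitProfile β i + d)
      (fun i => (if (i : ℕ) < f + 1 then 0 else A * unitProfile β (i - (f + 1))) + d)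
      ≤ poissonOverlap (fun i => x1 i + d) (fun i => x2 i + d) := by
  have diff (x y : Fin (f + 1 + k) → ℝ) (hx : ∀ i, 0 ≤ x i ∧ x i ≤ A)
      (hy : ∀ i, 0 ≤ y i ∧ y i ≤ A) (hs : ∑ i, x i ≤ A * β) :
      (∀ i, 0 ≤ max (x i - y i) 0 / A) ∧ (∀ i, max (x i - y i) 0 / A ≤ 1) ∧
        ∑ i, max (x i - y i) 0 / A ≤ β := by
    refine ⟨fun i => div_nonneg (le_max_right _ _) hA.le, fun i => ?_, ?_⟩
    · exact (div_le_one hA).2 (max_le (by linarith [hx i, hy i]) hA.le)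
    · rw [← Finset.sum_div, div_le_iff₀ hA, mul_comm]
      exact (Finset.sum_le_sum fun i _ =>
        max_le (by linarith [hy i]) (hx i).1).trans hs
  obtain ⟨hu0, hu1, hu⟩ := diff x1 x2 hx1 hx2 hs1
  obtain ⟨hv0, hv1, hv⟩ := diff x2 x1 hx2 hx1 hs2
  have hvk : ∑ i, max (x2 i - x1 i) 0 / A ≤ k := by
    rw [← Finset.sum_div, div_le_iff₀ hA]
    refine (sum_max_sub_le x2 x1 (fun i => (hx2 i).2) fun i => (hx1 i).1).trans ?_
    refine mul_le_mul_of_nonneg_right ?_ hA.le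
    have := Finset.card_filter_add_card_filter_not (s := Finset.univ) fun i => x2 i ≤ x1 i
    simp only [not_le, Finset.card_univ, Fintype.card_fin] at this
    exact_mod_cast (by omega : (Finset.univ.filter fun i => x1 i < x2 i).card ≤ k)
  obtain ⟨E, hE0, hE1, hE2, hE3⟩ :=
    exists_substochastic_unitProfile hf hf1 (f + 1) _ hu0 hu1 hu (.inl le_rfl)
  obtain ⟨F, hF0, hF1, hF2, hF3⟩ :=
    exists_substochastic_unitProfile hf hf1 k _ hv0 hv1 hv (.inr hvk)
  set g : Fin (f + 1 + k) → ℕ → ℝ := fun i j => if x2 i ≤ x1 i then E i j else 0 with hg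
  set h : Fin (f + 1 + k) → ℕ → ℝ := fun i j => if x2 i ≤ x1 i then 0 else F i j with hh
  set D : Fin (f + 1 + k) → Fin (f + 1 + k) → ℝ :=
    fun i j => if (j : ℕ) < f + 1 then g i j else h i (j - (f + 1)) with hD
  have hg0 (i j) : 0 ≤ g i j := ite_nonneg (hE0 i j) le_rfl
  have hh0 (i j) : 0 ≤ h i j := ite_nonneg le_rfl (hF0 i j)
  have hD0 (i j) : 0 ≤ D i j := ite_nonneg (hg0 i _) (hh0 i _)
  have hDcol (j) : ∑ i, D i j ≤ 1 := by
    simp only [hD]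
    split_ifs
    · refine (Finset.sum_le_sum fun i _ => ?_).trans (hE1 j)
      simp only [hg]
      split_ifs
      exacts [le_rfl, hE0 i j]
    · refine (Finset.sum_le_sum fun i _ => ?_).trans (hF1 (j - (f + 1)))
      simp only [hh]
      split_ifs
      exacts [hF0 i _, le_rfl]
  have hDrow (i) : ∑ j, D i j ≤ 1 := by
    rw [sum_fin_add_ite (f + 1) k (g i) (h i)]
    simp only [hg, hh]
    split_ifs
    · simpa using hE2 i
    · simpa using hF2 i
  have hD1 (i) : ∑ j, D i j * (A * unitProfile β j) = max (x1 i - x2 i) 0 := by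
    have e (j : Fin (f + 1 + k)) : D i j * (A * unitProfile β j)
        = if (j : ℕ) < f + 1 then A * (g i j * unitProfile β j) else (0 : ℕ → ℝ) (j - (f + 1)) := by
      simp only [hD]
      split_ifs with hj
      · ring
      · have : ((f + 1 : ℕ) : ℝ) ≤ (j : ℕ) := by exact_mod_cast not_lt.1 hj
        rw [unitProfile_eq_zero (by push_cast at this; linarith)]
        simp
    simp only [e]
    rw [sum_fin_add_ite (f + 1) k (fun j => A * (g i j * unitProfile β j)), ← Finset.mul_sum]
    simp only [hg]
    split_ifs with hi
    · rw [hE3]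
      simp only [Pi.zero_apply, Finset.sum_const_zero, add_zero]
      field_simp
    · rw [max_eq_right (by linarith)]
      simp
  have hD2 (i) : ∑ j : Fin (f + 1 + k),
      D i j * (if (j : ℕ) < f + 1 then 0 else A * unitProfile β (j - (f + 1)))
        = max (x2 i - x1 i) 0 := by
    have e (j : Fin (f + 1 + k)) :
        D i j * (if (j : ℕ) < f + 1 then 0 else A * unitProfile β (j - (f + 1)))
        = if (j : ℕ) < f + 1 then (0 : ℕ → ℝ) j
          else (fun j => A * (h i j * unitProfile β j)) (j - (f + 1)) := by
      simp only [hD]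
      split_ifs with hj
      · simp
      · ring
    simp only [e]
    rw [sum_fin_add_ite (f + 1) k 0 (fun j => A * (h i j * unitProfile β j)), ← Finset.mul_sum]
    simp only [hh]
    split_ifs with hi
    · rw [max_eq_right (by linarith)]
      simp
    · rw [hF3]
      simp only [Pi.zero_apply, Finset.sum_const_zero, zero_add]
      field_simp
  have hprof (j : ℕ) : 0 ≤ A * unitProfile β j := mul_nonneg hA.le (unitProfile_nonneg β j)
  refine (poissonOverlap_le_of_substochastic D hD0 hDcol _ _
    (fun i => min (x1 i) (x2 i) + d * (1 - ∑ j, D i j))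
    (fun j => add_nonneg (hprof j) hd.le)
    (fun j => add_nonneg (ite_nonneg le_rfl (hprof _)) hd.le)
    (fun i => add_nonneg (le_min (hx1 i).1 (hx2 i).1)
      (mul_nonneg hd.le (sub_nonneg.2 (hDrow i))))).trans_eq ?_
  congr 1
  · funext i
    simp only [mul_add, Finset.sum_add_distrib, hD1, ← Finset.sum_mul]
    rcases le_total (x1 i) (x2 i) with hi | hi
    · rw [min_eq_left hi, max_eq_right (by linarith)]
      ring
    · rw [min_eq_right hi, max_eq_left (by linarith)]
      ring
  · funext i
    simp only [mul_add, Finset.sum_add_distrib, hD2, ← Finset.sum_mul]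
    rcases le_total (x1 i) (x2 i) with hi | hi
    · rw [min_eq_left hi, max_eq_left (by linarith)]
      ring
    · rw [min_eq_right hi, max_eq_right (by linarith)]
      ring

lemma poissonPdf_rpow_mul_rpow {a b s : ℝ} (ha : 0 ≤ a) (hb : 0 ≤ b) (k : ℕ) :
    poissonPdf a k ^ (1 - s) * poissonPdf b k ^ s
      = Real.exp (-((1 - s) * a + s * b - a ^ (1 - s) * b ^ s))
        * poissonPdf (a ^ (1 - s) * b ^ s) k := by
  have hk : (0 : ℝ) < k.factorial := by positivity
  have hpow {x : ℝ} (hx : 0 ≤ x) (t : ℝ) : (x ^ k) ^ t = (x ^ t) ^ k := by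
    rw [← Real.rpow_natCast, ← Real.rpow_natCast, ← Real.rpow_mul hx, ← Real.rpow_mul hx, mul_comm]
  have hfac : (k.factorial : ℝ) ^ (1 - s) * (k.factorial : ℝ) ^ s = k.factorial := by
    rw [← Real.rpow_add hk, sub_add_cancel, Real.rpow_one]
  have hexp : Real.exp (-((1 - s) * a + s * b - a ^ (1 - s) * b ^ s))
      * Real.exp (-(a ^ (1 - s) * b ^ s)) = Real.exp (-a * (1 - s)) * Real.exp (-b * s) := by
    rw [← Real.exp_add, ← Real.exp_add]
    congr 1
    ring
  unfold poissonPdf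
  rw [Real.div_rpow (by positivity) hk.le, Real.div_rpow (by positivity) hk.le,
    Real.mul_rpow (by positivity) (by positivity), Real.mul_rpow (by positivity) (by positivity),
    ← Real.exp_mul, ← Real.exp_mul, hpow ha, hpow hb, mul_pow, div_mul_div_comm, hfac,
    ← mul_div_assoc, ← mul_assoc (Real.exp _) (Real.exp _), hexp]
  ring

/-- Chernoff bound on the overlap. -/
lemma poissonOverlap_le_exp {n : ℕ} {s : ℝ} (hs0 : 0 ≤ s) (hs1 : s ≤ 1) (a b : Fin n → ℝ)
    (ha : ∀ i, 0 ≤ a i) (hb : ∀ i, 0 ≤ b i) :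
    poissonOverlap a b ≤ ENNReal.ofReal
      (Real.exp (-∑ i, ((1 - s) * a i + s * b i - a i ^ (1 - s) * b i ^ s))) := by
  have hpn {c : ℝ} (hc : 0 ≤ c) (k : ℕ) := poissonPdf_nonneg hc k
  calc poissonOverlap a b
      ≤ ∑' y : Fin n → ℕ, ∏ i, ENNReal.ofReal
          (poissonPdf (a i) (y i) ^ (1 - s) * poissonPdf (b i) (y i) ^ s) := by
        refine ENNReal.tsum_le_tsum fun y => ?_
        rw [← ENNReal.ofReal_prod_of_nonneg fun i _ => mul_nonneg
          (Real.rpow_nonneg (hpn (ha i) _) _) (Real.rpow_nonneg (hpn (hb i) _) _)]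
        refine ENNReal.ofReal_le_ofReal ?_
        rw [Finset.prod_mul_distrib, Real.finsetProd_rpow _ _ fun i _ => hpn (ha i) _,
          Real.finsetProd_rpow _ _ fun i _ => hpn (hb i) _]
        set P := ∏ i, poissonPdf (a i) (y i)
        set Q := ∏ i, poissonPdf (b i) (y i)
        have hP : 0 ≤ P := Finset.prod_nonneg fun i _ => hpn (ha i) _
        have hQ : 0 ≤ Q := Finset.prod_nonneg fun i _ => hpn (hb i) _
        have hm : 0 ≤ min P Q := le_min hP hQ
        calc min P Q = min P Q ^ (1 - s) * min P Q ^ s := by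
              rw [← Real.rpow_add' hm (by simp), sub_add_cancel, Real.rpow_one]
          _ ≤ P ^ (1 - s) * Q ^ s :=
              mul_le_mul (Real.rpow_le_rpow hm (min_le_left _ _) (sub_nonneg.2 hs1))
                (Real.rpow_le_rpow hm (min_le_right _ _) hs0) (Real.rpow_nonneg hm _)
                (Real.rpow_nonneg hP _)
    _ = ∏ i, ENNReal.ofReal
          (Real.exp (-((1 - s) * a i + s * b i - a i ^ (1 - s) * b i ^ s))) := by
        rw [ENNReal_tsum_pi_prod fun i k => ENNReal.ofReal
          (poissonPdf (a i) k ^ (1 - s) * poissonPdf (b i) k ^ s)]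
        refine Finset.prod_congr rfl fun i _ => ?_
        simp_rw [poissonPdf_rpow_mul_rpow (ha i) (hb i), ENNReal.ofReal_mul (Real.exp_pos _).le]
        rw [ENNReal.tsum_mul_left, tsum_ofReal_poissonPdf
          (mul_nonneg (Real.rpow_nonneg (ha i) _) (Real.rpow_nonneg (hb i) _)), mul_one]
    _ = _ := by
        rw [← ENNReal.ofReal_prod_of_nonneg fun i _ => (Real.exp_pos _).le, ← Real.exp_sum,
          Finset.sum_neg_distrib]

/-- The all-zero observation bounds the overlap from below. -/
lemma ofReal_exp_le_poissonOverlap {ι : Type*} [Fintype ι] {a b : ι → ℝ} {T : ℝ}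
    (ha : ∑ i, a i ≤ T) (hb : ∑ i, b i ≤ T) :
    ENNReal.ofReal (Real.exp (-T)) ≤ poissonOverlap a b := by
  refine le_trans ?_ (ENNReal.le_tsum (0 : ι → ℕ))
  refine ENNReal.ofReal_le_ofReal (le_min ?_ ?_) <;>
  · simp only [poissonPdf, Pi.zero_apply, pow_zero, mul_one, Nat.factorial_zero, Nat.cast_one,
      div_one]
    rw [← Real.exp_sum, Finset.sum_neg_distrib]
    exact Real.exp_le_exp.2 (neg_le_neg ‹_›)

lemma ofReal_exp_le_poissonOverlap_of_card {n f : ℕ} {A d : ℝ} (hA : 0 < A) (hd : 0 < d)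
    (x1 x2 : Fin n → ℝ) (hx1 : ∀ i, 0 ≤ x1 i ∧ x1 i ≤ A) (hx2 : ∀ i, 0 ≤ x2 i ∧ x2 i ≤ A)
    (h1 : (Finset.univ.filter fun i => x2 i ≤ x1 i).card ≤ f)
    (h2 : (Finset.univ.filter fun i => x1 i ≤ x2 i).card ≤ f) :
    ENNReal.ofReal (Real.exp (-(f * A + n * d)))
      ≤ poissonOverlap (fun i => x1 i + d) (fun i => x2 i + d) := by
  have total (x y : Fin n → ℝ) (hx : ∀ i, 0 ≤ x i ∧ x i ≤ A) (hy : ∀ i, 0 ≤ y i ∧ y i ≤ A)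
      (h : (Finset.univ.filter fun i => y i ≤ x i).card ≤ f) :
      ∑ i, (max (x i - y i) 0 + d) ≤ f * A + n * d := by
    rw [Finset.sum_add_distrib]
    simp only [Finset.sum_const, Finset.card_univ, Fintype.card_fin, nsmul_eq_mul]
    refine add_le_add_left
      ((sum_max_sub_le x y (fun i => (hx i).2) fun i => (hy i).1).trans ?_) _
    refine mul_le_mul_of_nonneg_right ?_ hA.le
    have hsub : (Finset.univ.filter fun i => y i < x i) ⊆ Finset.univ.filter fun i => y i ≤ x i :=
      Finset.monotone_filter_right _ fun i _ => le_of_lt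
    exact_mod_cast (Finset.card_le_card hsub).trans h
  refine (ofReal_exp_le_poissonOverlap (total x1 x2 hx1 hx2 h1) (total x2 x1 hx2 hx1 h2)).trans ?_
  refine (poissonOverlap_le_of_substochastic (fun i j => if i = j then 1 else 0)
    (fun i j => ite_nonneg zero_le_one le_rfl) (fun j => by simp) _ _
    (fun i => min (x1 i) (x2 i))
    (fun i => add_nonneg (le_max_right _ _) hd.le) (fun i => add_nonneg (le_max_right _ _) hd.le)
    (fun i => le_min (hx1 i).1 (hx2 i).1)).trans_eq ?_
  simp only [ite_mul, one_mul, zero_mul, Finset.sum_ite_eq, Finset.mem_univ, if_true]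
  congr 1 <;> funext i <;> rcases le_total (x1 i) (x2 i) with hi | hi
  · rw [min_eq_left hi, max_eq_right (by linarith)]
    ring
  · rw [min_eq_right hi, max_eq_left (by linarith)]
    ring
  · rw [min_eq_left hi, max_eq_left (by linarith)]
    ring
  · rw [min_eq_right hi, max_eq_right (by linarith)]
    ring

lemma poissonOverlap_staggered_le_exp {A β d s : ℝ} {f k : ℕ} (hA : 0 < A) (hd : 0 < d)
    (hf : (f : ℝ) < β) (hf1 : β ≤ f + 1) (hs0 : 0 ≤ s) (hs1 : s ≤ 1) :
    poissonOverlap (fun i : Fin (f + 1 + k) => A * unitProfile β i + d)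
      (fun i => (if (i : ℕ) < f + 1 then 0 else A * unitProfile β (i - (f + 1))) + d)
      ≤ ENNReal.ofReal (Real.exp
        (-((1 - s) * β * A - (f + 1 + k : ℕ) * ((A + d) ^ (1 - s) * d ^ s)))) := by
  have hprof (j : ℕ) : 0 ≤ A * unitProfile β j := mul_nonneg hA.le (unitProfile_nonneg β j)
  have ha (i : Fin (f + 1 + k)) : 0 ≤ A * unitProfile β i + d := add_nonneg (hprof i) hd.le
  have hb (i : Fin (f + 1 + k)) :
      0 ≤ (if (i : ℕ) < f + 1 then 0 else A * unitProfile β (i - (f + 1))) + d :=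
    add_nonneg (ite_nonneg le_rfl (hprof _)) hd.le
  refine (poissonOverlap_le_exp hs0 hs1 _ _ ha hb).trans ?_
  refine ENNReal.ofReal_le_ofReal (Real.exp_le_exp.2 (neg_le_neg ?_))
  have hC : 0 ≤ (A + d) ^ (1 - s) * d ^ s := by positivity
  have hsum : ∑ i : Fin (f + 1 + k),
      ((1 - s) * A * unitProfile β i - (A + d) ^ (1 - s) * d ^ s)
      = (1 - s) * β * A - (f + 1 + k : ℕ) * ((A + d) ^ (1 - s) * d ^ s) := by
    have hw : ∑ i : Fin (f + 1 + k), unitProfile β i = β := by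
      rw [Fin.sum_univ_eq_sum_range (unitProfile β), Finset.sum_range_add,
        sum_range_unitProfile hf hf1, Finset.sum_eq_zero, add_zero]
      intro j _
      refine unitProfile_eq_zero ?_
      push_cast
      linarith [(Nat.cast_nonneg j : (0 : ℝ) ≤ j)]
    rw [Finset.sum_sub_distrib, ← Finset.mul_sum, hw]
    simp only [Finset.sum_const, Finset.card_univ, Fintype.card_fin, nsmul_eq_mul]
    ring
  rw [← hsum]
  refine Finset.sum_le_sum fun i _ => ?_
  by_cases hi : (i : ℕ) < f + 1
  · rw [if_pos hi, zero_add]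
    have hle : (A * unitProfile β i + d) ^ (1 - s) * d ^ s ≤ (A + d) ^ (1 - s) * d ^ s := by
      refine mul_le_mul_of_nonneg_right (Real.rpow_le_rpow (ha i) ?_ (sub_nonneg.2 hs1))
        (Real.rpow_nonneg hd.le _)
      have := mul_le_mul_of_nonneg_left (unitProfile_le_one β i) hA.le
      linarith
    nlinarith
  · have hi' : ((f + 1 : ℕ) : ℝ) ≤ (i : ℕ) := by exact_mod_cast not_lt.1 hi
    have hw : unitProfile β i = 0 := unitProfile_eq_zero (by push_cast at hi'; linarith)
    have := Real.geom_mean_le_arith_mean2_weighted (sub_nonneg.2 hs1) hs0 (ha i) (hb i)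
      (sub_add_cancel 1 s)
    rw [hw] at this ⊢
    linarith

lemma exists_threshold {d s δ : ℝ} (hd : 0 < d) (hs : 0 < s) (hδ : 0 < δ) (C T : ℝ) :
    ∃ A₀ : ℝ, 0 < A₀ ∧ ∀ A, A₀ ≤ A → C * ((A + d) ^ (1 - s) * d ^ s) + T ≤ δ * A := by
  have hlim : Filter.Tendsto (fun t : ℝ => C * d ^ s * t ^ (-s)) Filter.atTop (nhds 0) := by
    simpa using (tendsto_rpow_neg_atTop hs).const_mul (C * d ^ s)
  have hev := (hlim.eventually_le_const (half_pos hδ)).and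
    (Filter.eventually_ge_atTop ((δ * d + T) / (δ / 2)))
  obtain ⟨t₀, ht₀⟩ := Filter.eventually_atTop.1 hev
  refine ⟨max t₀ 1, by positivity, fun A hA => ?_⟩
  have hA1 : 1 ≤ A := (le_max_right _ _).trans hA
  have hpos : 0 < A + d := by linarith
  obtain ⟨h1, h2⟩ := ht₀ (A + d) (by linarith [(le_max_left t₀ 1).trans hA])
  rw [div_le_iff₀ (half_pos hδ)] at h2
  have h3 : (A + d) ^ (1 - s) = (A + d) * (A + d) ^ (-s) := by
    rw [sub_eq_add_neg, Real.rpow_add hpos, Real.rpow_one]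
  have h4 := mul_le_mul_of_nonneg_left h1 hpos.le
  rw [h3]
  nlinarith

lemma poissonOverlap_le_one {n : ℕ} (a b : Fin n → ℝ) (ha : ∀ i, 0 ≤ a i) (hb : ∀ i, 0 ≤ b i) :
    poissonOverlap a b ≤ 1 := by
  simpa using poissonOverlap_le_exp le_rfl zero_le_one a b ha hb

lemma Pe_le_Pe_of_poissonOverlap_le {n : ℕ} {d : ℝ} (hd : 0 < d) {l m l' m' : Fin n → ℝ}
    (hl : ∀ i, 0 ≤ l i) (hm : ∀ i, 0 ≤ m i) (hl' : ∀ i, 0 ≤ l' i) (hm' : ∀ i, 0 ≤ m' i)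
    (h : poissonOverlap (fun i => l i + d) (fun i => m i + d)
      ≤ poissonOverlap (fun i => l' i + d) (fun i => m' i + d)) :
    Pe d l m ≤ Pe d l' m' := by
  rw [Pe_eq_half_poissonOverlap hd l m hl hm, Pe_eq_half_poissonOverlap hd l' m' hl' hm']
  refine mul_le_mul_of_nonneg_left (ENNReal.toReal_mono ?_ h) (by norm_num)
  exact ((poissonOverlap_le_one _ _ (fun i => add_nonneg (hl' i) hd.le)
    fun i => add_nonneg (hm' i) hd.le).trans_lt ENNReal.one_lt_top).ne

/-- Memoryless channel (`K = 1`, `π₀ = 1`), joint peak-power constraint `A` and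
total-power constraint `P = Aβ`, with `N ≥ ⌊β⌋ + 1`: for all sufficiently large `A`
the pair `x1*_i = κ_i`, `x2*_i = κ_{i − ⌈β⌉}` is optimal. -/
theorem stmt4 (d : ℝ) (hd : 0 < d) (β : ℝ) (hβ : 0 < β) (N : ℕ)
    (hN : (⌊β⌋ + 1 : ℤ) ≤ (N : ℤ)) :
    ∃ Astar : ℝ, 0 < Astar ∧ ∀ A : ℝ, Astar ≤ A →
      ∀ x1 x2 : Fin N → ℝ,
        (∀ i, 0 ≤ x1 i ∧ x1 i ≤ A) → (∀ i, 0 ≤ x2 i ∧ x2 i ≤ A) →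
        (∑ i, x1 i) ≤ A * β → (∑ i, x2 i) ≤ A * β →
        Pe d (fun i : Fin N => kap A β ((i : ℕ) : ℤ))
             (fun i : Fin N => kap A β (((i : ℕ) : ℤ) - ⌈β⌉))
          ≤ Pe d x1 x2 := by
  obtain ⟨f, hfc⟩ : ∃ f : ℕ, ⌈β⌉ = ((f + 1 : ℕ) : ℤ) :=
    ⟨(⌈β⌉ - 1).toNat, by have := Int.ceil_pos.2 hβ; omega⟩
  have hf : (f : ℝ) < β := by
    have : (f : ℤ) < ⌈β⌉ := by rw [hfc]; push_cast; omega
    exact_mod_cast Int.lt_ceil.1 this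
  have hf1 : β ≤ f + 1 := by
    have := Int.le_ceil β
    rw [hfc] at this
    exact_mod_cast this
  have hfN : f + 1 ≤ N := by
    have : (f : ℤ) ≤ ⌊β⌋ := Int.le_floor.2 (by exact_mod_cast hf.le)
    omega
  obtain ⟨k, rfl⟩ := Nat.exists_eq_add_of_le hfN
  obtain ⟨s, hs0, hs1, hsβ⟩ : ∃ s : ℝ, 0 < s ∧ s ≤ 1 ∧ 0 < (1 - s) * β - f := by
    have hf0 : (0 : ℝ) ≤ f := f.cast_nonneg
    refine ⟨(β - f) / (2 * β), div_pos (by linarith) (by linarith),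
      (div_le_one (by linarith)).2 (by linarith), ?_⟩
    have : (β - f) / (2 * β) * β = (β - f) / 2 := by field_simp
    linarith
  obtain ⟨A₀, hA₀, hA₀'⟩ := exists_threshold hd hs0 hsβ ((f + 1 + k : ℕ) : ℝ)
    ((f + 1 + k : ℕ) * d)
  refine ⟨A₀, hA₀, fun A hA x1 x2 hx1 hx2 hs1' hs2' => ?_⟩
  have hApos : 0 < A := hA₀.trans_le hA
  have hprof (j : ℕ) : 0 ≤ A * unitProfile β j :=
    mul_nonneg hApos.le (unitProfile_nonneg β j)
  simp only [hfc, kap_natCast, kap_sub]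
  refine Pe_le_Pe_of_poissonOverlap_le hd (fun i => hprof i)
    (fun i => ite_nonneg le_rfl (hprof _)) (fun i => (hx1 i).1) (fun i => (hx2 i).1) ?_
  rcases Nat.lt_or_ge f (Finset.univ.filter fun i => x2 i ≤ x1 i).card with h1 | h1
  · exact poissonOverlap_staggered_le hApos hd hf hf1 x1 x2 hx1 hx2 hs1' hs2' h1
  rcases Nat.lt_or_ge f (Finset.univ.filter fun i => x1 i ≤ x2 i).card with h2 | h2
  · rw [poissonOverlap_comm fun i => x1 i + d]
    exact poissonOverlap_staggered_le hApos hd hf hf1 x2 x1 hx2 hx1 hs2' hs1' h2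
  refine (poissonOverlap_staggered_le_exp hApos hd hf hf1 hs0.le hs1).trans
    (le_trans ?_ (ofReal_exp_le_poissonOverlap_of_card hApos hd x1 x2 hx1 hx2 h1 h2))
  refine ENNReal.ofReal_le_ofReal (Real.exp_le_exp.2 (neg_le_neg ?_))
  have := hA₀' A hA
  linarith
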